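/- Let 1/2 < β < β′ < 1 with β + β′ > 1, let 1 − β′ < α < β, and let T₁ < T₂ < T₃. Let z : [T₁,T₃] → ℝ be β-Hölder continuous and ζ : [T₁,T₃] → ℝ be β′-Hölder continuous. For a ≤ b in [T₁,T₃] set I(a,b) = ∫_a^b D^α_{a+}z[r] · D^{1−α}_{b−}ζ_{b−}[r] dr, where the fractional derivatives are taken with respect to the interval [a,b]. Then all these integrals are well defined and the additivity property I(T₁,T₂) + I(T₂,T₃) = I(T₁,T₃) holds. -/

import Mathlib

open Set MeasureTheory

/-- The left-sided Weyl fractional derivative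
`D^α_{a+}z[r] = (1/Γ(1−α)) ( z(r)/(r−a)^α + α ∫_a^r (z(r)−z(q))/(r−q)^{1+α} dq )`. -/
noncomputable def fracDerivLeft (α a : ℝ) (z : ℝ → ℝ) (r : ℝ) : ℝ :=
  (1 / Real.Gamma (1 - α)) *
    (((r - a) ^ (-α)) * z r +
      α * ∫ q in a..r, ((r - q) ^ (-(1 + α))) * (z r - z q))

/-- The right-sided Weyl fractional derivative (up to the unimodular factor `(−1)^{1−α}`)
`D^{1−α}_{b−}ζ_{b−}[r] = (1/Γ(α)) ( (ζ(r)−ζ(b))/(b−r)^{1−α}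
  + (1−α) ∫_r^{b} (ζ(r)−ζ(q))/(q−r)^{2−α} dq )`. -/
noncomputable def fracDerivRight (α b : ℝ) (ζ : ℝ → ℝ) (r : ℝ) : ℝ :=
  (1 / Real.Gamma α) *
    (((b - r) ^ (-(1 - α))) * (ζ r - ζ b) +
      (1 - α) * ∫ q in r..b, ((q - r) ^ (-(2 - α))) * (ζ r - ζ q))


/-- Global Hölder condition. -/
def HoldG (K β : ℝ) (z : ℝ → ℝ) : Prop := ∀ s t : ℝ, |z t - z s| ≤ K * |t - s| ^ β

lemma HoldG.K_nonneg {K β : ℝ} {z : ℝ → ℝ} (h : HoldG K β z) : 0 ≤ K := by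
  have := h 0 1
  simp at this
  exact (abs_nonneg _).trans this

lemma HoldG.cont {K β : ℝ} {z : ℝ → ℝ} (h : HoldG K β z) (hβ : 0 < β) : Continuous z := by
  rw [continuous_iff_continuousAt]
  intro x
  rw [ContinuousAt, tendsto_iff_dist_tendsto_zero]
  have h1 : Filter.Tendsto (fun t : ℝ => K * |t - x| ^ β) (nhds x) (nhds 0) := by
    have : Continuous (fun t : ℝ => K * |t - x| ^ β) := by
      refine continuous_const.mul (Continuous.rpow_const (by fun_prop) ?_)
      intro _; right; exact hβ.le
    have h2 := this.tendsto x
    simpa [Real.zero_rpow hβ.ne'] using h2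
  refine squeeze_zero (fun _ => dist_nonneg) (fun t => ?_) h1
  rw [Real.dist_eq]
  exact h x t

lemma kern_ii (c : ℝ) (hc : -1 < c) (a r : ℝ) :
    IntervalIntegrable (fun q => (r - q) ^ c) volume a r := by
  have h := (intervalIntegral.intervalIntegrable_rpow' (a := r - a) (b := 0) hc).comp_sub_left r
  simpa using h

lemma kern_ii' (c : ℝ) (hc : -1 < c) (a r : ℝ) :
    IntervalIntegrable (fun q => (q - a) ^ c) volume a r := by
  have h := (intervalIntegral.intervalIntegrable_rpow' (a := 0) (b := r - a) hc).comp_sub_right a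
  simpa using h

lemma kern_bound {γ β K r q : ℝ} {z : ℝ → ℝ} (h : HoldG K β z) (hq : q ≤ r) :
    ‖(r - q) ^ (-(1 + γ)) * (z r - z q)‖ ≤ K * (r - q) ^ (β - γ - 1) := by
  rcases hq.eq_or_lt with rfl | hq
  · simp
    exact mul_nonneg h.K_nonneg (Real.rpow_nonneg le_rfl _)
  have hp : 0 < r - q := sub_pos.2 hq
  rw [norm_mul, Real.norm_eq_abs, Real.norm_eq_abs, abs_of_pos (Real.rpow_pos_of_pos hp _)]
  have h1 := h q r
  rw [abs_of_pos hp] at h1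
  calc (r - q) ^ (-(1 + γ)) * |z r - z q| ≤ (r - q) ^ (-(1 + γ)) * (K * (r - q) ^ β) := by
        gcongr
    _ = K * (r - q) ^ (β - γ - 1) := by
        rw [mul_left_comm, ← Real.rpow_add hp]; congr 2; ring

lemma kern_meas {γ r : ℝ} {z : ℝ → ℝ} (hz : Continuous z) :
    Measurable (fun q => (r - q) ^ (-(1 + γ)) * (z r - z q)) := by
  have := hz.measurable
  fun_prop

lemma kernz_ii {γ β K a r : ℝ} {z : ℝ → ℝ} (h : HoldG K β z) (ha : a ≤ r) (hγ : γ < β)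
    (hβ : 0 < β) :
    IntervalIntegrable (fun q => (r - q) ^ (-(1 + γ)) * (z r - z q)) volume a r := by
  refine IntervalIntegrable.mono_fun' ((kern_ii (β - γ - 1) (by linarith) a r).const_mul K)
    (kern_meas (h.cont hβ)).aestronglyMeasurable ?_
  refine (ae_restrict_mem measurableSet_uIoc).mono ?_
  intro q hq
  rw [uIoc_of_le ha] at hq
  exact kern_bound h hq.2

lemma left_bound {γ β K a r : ℝ} {z : ℝ → ℝ} (h : HoldG K β z) (ha : a < r) (hγ : γ < β)
    (hγ0 : 0 < γ) (hγ1 : γ < 1) :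
    |fracDerivLeft γ a z r| ≤ (1 / Real.Gamma (1 - γ)) *
      ((r - a) ^ (-γ) * |z r| + γ * (K * ((r - a) ^ (β - γ) / (β - γ)))) := by
  have hG : 0 < Real.Gamma (1 - γ) := Real.Gamma_pos_of_pos (by linarith)
  have hp : 0 < r - a := sub_pos.2 ha
  unfold fracDerivLeft
  rw [abs_mul, abs_of_pos (by positivity : 0 < 1 / Real.Gamma (1 - γ))]
  gcongr
  refine (abs_add_le _ _).trans ?_
  rw [abs_mul, abs_mul, abs_of_pos hγ0, abs_of_pos (Real.rpow_pos_of_pos hp _)]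
  gcongr
  have h1 := intervalIntegral.norm_integral_le_of_norm_le (μ := volume)
    (f := fun q => (r - q) ^ (-(1 + γ)) * (z r - z q))
    (g := fun q => K * (r - q) ^ (β - γ - 1)) ha.le
    (Filter.Eventually.of_forall fun q hq => kern_bound h hq.2)
    ((kern_ii (β - γ - 1) (by linarith) a r).const_mul K)
  refine h1.trans (le_of_eq ?_)
  rw [intervalIntegral.integral_const_mul,
    intervalIntegral.integral_comp_sub_left (fun x => x ^ (β - γ - 1)) r,
    integral_rpow (Or.inl (by linarith))]
  have : β - γ - 1 + 1 = β - γ := by ring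
  rw [this, sub_self, Real.zero_rpow (by linarith), sub_zero]

lemma left_meas {γ a : ℝ} {z : ℝ → ℝ} (hz : Continuous z) :
    Measurable (fun r => fracDerivLeft γ a z r) := by
  have hzm := hz.measurable
  have key : ∀ S : Set (ℝ × ℝ), MeasurableSet S →
      Measurable (fun r : ℝ => ∫ q, S.indicator
        (fun p : ℝ × ℝ => (p.1 - p.2) ^ (-(1 + γ)) * (z p.1 - z p.2)) (r, q)) := by
    intro S hS
    refine (StronglyMeasurable.integral_prod_right' (ν := volume) ?_).measurable
    refine (Measurable.indicator ?_ hS).stronglyMeasurable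
    fun_prop
  have e : ∀ r : ℝ, (∫ q in a..r, ((r - q) ^ (-(1 + γ))) * (z r - z q)) =
      (∫ q, {p : ℝ × ℝ | a < p.2 ∧ p.2 ≤ p.1}.indicator
        (fun p : ℝ × ℝ => (p.1 - p.2) ^ (-(1 + γ)) * (z p.1 - z p.2)) (r, q)) -
      (∫ q, {p : ℝ × ℝ | p.1 < p.2 ∧ p.2 ≤ a}.indicator
        (fun p : ℝ × ℝ => (p.1 - p.2) ^ (-(1 + γ)) * (z p.1 - z p.2)) (r, q)) := by
    intro r
    rw [intervalIntegral, ← integral_indicator measurableSet_Ioc,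
      ← integral_indicator measurableSet_Ioc]
    rfl
  unfold fracDerivLeft
  simp_rw [e]
  have m1 := key {p : ℝ × ℝ | a < p.2 ∧ p.2 ≤ p.1} (by
    exact (measurableSet_lt measurable_const measurable_snd).inter
      (measurableSet_le measurable_snd measurable_fst))
  have m2 := key {p : ℝ × ℝ | p.1 < p.2 ∧ p.2 ≤ a} (by
    exact (measurableSet_lt measurable_fst measurable_snd).inter
      (measurableSet_le measurable_snd measurable_const))
  have m3 : Measurable (fun r : ℝ => (r - a) ^ (-γ) * z r) := by fun_prop
  exact (m3.add ((m1.sub m2).const_mul γ)).const_mul _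

lemma left_tendsto {γ β K a r : ℝ} {z : ℝ → ℝ} {zn : ℕ → ℝ → ℝ} (hn : ∀ n, HoldG K β (zn n))
    (ha : a ≤ r) (hγ : γ < β) (hβ : 0 < β)
    (ht : ∀ x, Filter.Tendsto (fun n => zn n x) Filter.atTop (nhds (z x))) :
    Filter.Tendsto (fun n => fracDerivLeft γ a (zn n) r) Filter.atTop
      (nhds (fracDerivLeft γ a z r)) := by
  unfold fracDerivLeft
  refine Filter.Tendsto.const_mul _ (Filter.Tendsto.add ((ht r).const_mul _)
    (Filter.Tendsto.const_mul _ ?_))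
  refine intervalIntegral.tendsto_integral_filter_of_dominated_convergence
    (fun q => K * (r - q) ^ (β - γ - 1)) ?_ ?_
    ((kern_ii (β - γ - 1) (by linarith) a r).const_mul K) ?_
  · exact Filter.Eventually.of_forall fun n => (kern_meas ((hn n).cont hβ)).aestronglyMeasurable
  · refine Filter.Eventually.of_forall fun n => Filter.Eventually.of_forall fun q hq => ?_
    rw [uIoc_of_le ha] at hq
    exact kern_bound (hn n) hq.2
  · exact Filter.Eventually.of_forall fun q _ => ((ht r).sub (ht q)).const_mul _

lemma left_C1 {γ β K a r : ℝ} {f f' : ℝ → ℝ} (h : HoldG K β f) (ha : a < r) (hγ : γ < β)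
    (hγ0 : 0 < γ) (hγ1 : γ < 1) (hf : ∀ x, HasDerivAt f (f' x) x) (hf' : Continuous f') :
    fracDerivLeft γ a f r = (1 / Real.Gamma (1 - γ)) *
      ((r - a) ^ (-γ) * f a + ∫ q in a..r, (r - q) ^ (-γ) * f' q) := by
  have hβ : 0 < β := hγ0.trans hγ
  have hp : 0 < r - a := sub_pos.2 ha
  have i1 := kernz_ii h ha.le hγ hβ
  have i2 : IntervalIntegrable (fun q => (r - q) ^ (-γ) * f' q) volume a r :=
    (kern_ii (-γ) (by linarith) a r).mul_continuousOn hf'.continuousOn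
  have key := intervalIntegral.integral_eq_sub_of_hasDerivAt_of_le
    (f := fun q => (r - q) ^ (-γ) * (f r - f q))
    (f' := fun q => γ * ((r - q) ^ (-(1 + γ)) * (f r - f q)) - (r - q) ^ (-γ) * f' q)
    ha.le ?_ ?_ ((i1.const_mul γ).sub i2)
  · rw [intervalIntegral.integral_sub (i1.const_mul γ) i2,
      intervalIntegral.integral_const_mul] at key
    simp only [sub_self, mul_zero, zero_sub] at key
    unfold fracDerivLeft
    congr 1
    linarith
  · intro q hq
    rcases hq.2.eq_or_lt with rfl | hlt
    · rw [ContinuousWithinAt, sub_self, sub_self, mul_zero, tendsto_zero_iff_norm_tendsto_zero]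
      have h1 : Filter.Tendsto (fun x : ℝ => K * |q - x| ^ (β - γ)) (nhds q) (nhds 0) := by
        have : Continuous (fun x : ℝ => K * |q - x| ^ (β - γ)) := by
          refine continuous_const.mul (Continuous.rpow_const (by fun_prop) ?_)
          intro _; right; linarith
        have h2 := this.tendsto q
        simpa [Real.zero_rpow (by linarith : β - γ ≠ 0)] using h2
      refine squeeze_zero' (Filter.Eventually.of_forall fun _ => norm_nonneg _) ?_
        (h1.mono_left nhdsWithin_le_nhds)
      refine eventually_nhdsWithin_of_forall fun x hx => ?_
      rcases hx.2.eq_or_lt with rfl | hx2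
      · simp [Real.zero_rpow (by linarith : β - γ ≠ 0)]
      have hp : 0 < q - x := sub_pos.2 hx2
      rw [norm_mul, Real.norm_eq_abs, Real.norm_eq_abs, abs_of_pos (Real.rpow_pos_of_pos hp _)]
      have h1 := h x q
      rw [abs_of_pos hp] at h1 ⊢
      calc (q - x) ^ (-γ) * |f q - f x| ≤ (q - x) ^ (-γ) * (K * (q - x) ^ β) := by
            gcongr
        _ = K * (q - x) ^ (β - γ) := by
            rw [mul_left_comm, ← Real.rpow_add hp]; congr 2; ring
    · have hp : 0 < r - q := sub_pos.2 hlt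
      refine ContinuousAt.continuousWithinAt ?_
      refine ContinuousAt.mul (ContinuousAt.rpow_const (by fun_prop) (Or.inl hp.ne')) ?_
      exact continuousAt_const.sub (hf q).continuousAt
  · intro q hq
    have hp : 0 < r - q := sub_pos.2 hq.2
    have d1 : HasDerivAt (fun q : ℝ => (r - q)) (-1) q := by
      simpa using (hasDerivAt_id q).const_sub r
    have d2 := d1.rpow_const (p := -γ) (Or.inl hp.ne')
    have d3 : HasDerivAt (fun q => f r - f q) (-f' q) q := (hf q).const_sub (f r)
    refine (d2.mul d3).congr_deriv ?_
    have : -(1 + γ) = -γ - 1 := by ring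
    rw [this]; ring

lemma right_eq_left (α b : ℝ) (ζ : ℝ → ℝ) (r : ℝ) :
    fracDerivRight α b ζ r = fracDerivLeft (1 - α) (-b) (fun x => ζ (-x) - ζ b) (-r) := by
  unfold fracDerivRight fracDerivLeft
  have h := intervalIntegral.integral_comp_neg (a := r) (b := b)
    (fun q => (-r - q) ^ (-(1 + (1 - α))) * (ζ (- -r) - ζ b - (ζ (-q) - ζ b)))
  rw [← h]
  have e1 : 1 - (1 - α) = α := by ring
  have e2 : -r - -b = b - r := by ring
  have e3 : -(1 + (1 - α)) = -(2 - α) := by ring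
  rw [e1, e2, e3, neg_neg]
  have hI : (∫ q in r..b, ((q - r) ^ (-(2 - α))) * (ζ r - ζ q)) =
      ∫ q in r..b, (-r - -q) ^ (-(2 - α)) * (ζ r - ζ b - (ζ (- -q) - ζ b)) := by
    refine intervalIntegral.integral_congr fun q _ => ?_
    simp only [neg_neg]
    have e4 : -r - -q = q - r := by ring
    rw [e4]; ring
  rw [hI]
  simp only [neg_neg]

lemma HoldG.refl_sub {K β : ℝ} {z : ℝ → ℝ} (h : HoldG K β z) (c : ℝ) :
    HoldG K β (fun x => z (-x) - c) := by
  intro s t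
  have := h (-s) (-t)
  have e : |(-t) - (-s)| = |t - s| := by rw [← abs_neg]; congr 1; ring
  rw [e] at this
  simpa using this

lemma right_C1 {α β K b r : ℝ} {g g' : ℝ → ℝ} (h : HoldG K β g) (hb : r < b) (hγ : 1 - α < β)
    (hα0 : 0 < α) (hα1 : α < 1) (hg : ∀ x, HasDerivAt g (g' x) x) (hg' : Continuous g') :
    fracDerivRight α b g r = -(1 / Real.Gamma α) * ∫ q in r..b, (q - r) ^ (α - 1) * g' q := by
  have hd : ∀ x, HasDerivAt (fun x => g (-x) - g b) (-g' (-x)) x := by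
    intro x
    have := ((hg (-x)).comp x (hasDerivAt_neg x)).sub_const (g b)
    refine this.congr_deriv (by ring)
  rw [right_eq_left, left_C1 (h.refl_sub (g b)) (by linarith) hγ (by linarith) (by linarith) hd
    (by fun_prop)]
  have h := intervalIntegral.integral_comp_neg (a := r) (b := b)
    (fun q => (-r - q) ^ (-(1 - α)) * -g' (-q))
  rw [← h]
  have e1 : 1 - (1 - α) = α := by ring
  have hI : (∫ q in r..b, (-r - -q) ^ (-(1 - α)) * -g' (- -q)) =
      ∫ q in r..b, -((q - r) ^ (α - 1) * g' q) := by
    refine intervalIntegral.integral_congr fun q _ => ?_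
    simp only [neg_neg]
    have e4 : -r - -q = q - r := by ring
    have e5 : -(1 - α) = α - 1 := by ring
    rw [e4, e5]; ring
  rw [hI, intervalIntegral.integral_neg, e1]
  simp

lemma right_meas {α b : ℝ} {ζ : ℝ → ℝ} (hζ : Continuous ζ) :
    Measurable (fun r => fracDerivRight α b ζ r) := by
  simp_rw [right_eq_left]
  have := left_meas (γ := 1 - α) (a := -b) (z := fun x => ζ (-x) - ζ b) (by fun_prop)
  exact this.comp measurable_neg

lemma right_tendsto {α β K b r : ℝ} {z : ℝ → ℝ} {zn : ℕ → ℝ → ℝ} (hn : ∀ n, HoldG K β (zn n))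
    (hb : r ≤ b) (hγ : 1 - α < β) (hβ : 0 < β)
    (ht : ∀ x, Filter.Tendsto (fun n => zn n x) Filter.atTop (nhds (z x))) :
    Filter.Tendsto (fun n => fracDerivRight α b (zn n) r) Filter.atTop
      (nhds (fracDerivRight α b z r)) := by
  simp_rw [right_eq_left]
  exact left_tendsto (zn := fun n x => zn n (-x) - zn n b) (fun n => (hn n).refl_sub (zn n b))
    (by linarith) hγ hβ
    (fun x => (ht (-x)).sub (ht b))

lemma right_bound {α β K a b r : ℝ} {ζ : ℝ → ℝ} (h : HoldG K β ζ) (ha : a ≤ r) (hb : r ≤ b)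
    (hγ : 1 - α < β) (hα0 : 0 < α) (hα1 : α < 1) :
    |fracDerivRight α b ζ r| ≤ (1 / Real.Gamma α) *
      ((K + (1 - α) * K / (β - (1 - α))) * (b - a) ^ (β - (1 - α))) := by
  have hG : 0 < Real.Gamma α := Real.Gamma_pos_of_pos hα0
  have hK := h.K_nonneg
  have hd : 0 < β - (1 - α) := by linarith
  have hα : 0 ≤ 1 - α := by linarith
  have hc : 0 ≤ K + (1 - α) * K / (β - (1 - α)) := by positivity
  have hab : 0 ≤ b - a := by linarith
  rcases hb.eq_or_lt with rfl | hb
  · have : fracDerivRight α r ζ r = 0 := by simp [fracDerivRight]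
    rw [this, abs_zero]
    positivity
  have hp : 0 < b - r := sub_pos.2 hb
  rw [right_eq_left]
  refine (left_bound (h.refl_sub (ζ b)) (by linarith) hγ (by linarith) (by linarith)).trans ?_
  have e1 : 1 - (1 - α) = α := by ring
  have e2 : -r - -b = b - r := by ring
  rw [e1, e2, neg_neg]
  gcongr
  have h1 := h b r
  have e3 : |r - b| = b - r := by rw [abs_sub_comm, abs_of_pos hp]
  rw [e3] at h1
  calc _ ≤ (b - r) ^ (-(1 - α)) * (K * (b - r) ^ β) +
        (1 - α) * (K * ((b - r) ^ (β - (1 - α)) / (β - (1 - α)))) := by gcongr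
    _ = (K + (1 - α) * K / (β - (1 - α))) * (b - r) ^ (β - (1 - α)) := by
        rw [mul_left_comm, ← Real.rpow_add hp]
        have : -(1 - α) + β = β - (1 - α) := by ring
        rw [this]; field_simp
    _ ≤ _ := by gcongr

lemma prod_dom {α β β' K K' a b M : ℝ} (hab : a ≤ b) (hβ : α < β) (hβ' : 1 - α < β')
    (hα0 : 0 < α) (hα1 : α < 1) :
    ∃ bd : ℝ → ℝ, IntervalIntegrable bd volume a b ∧ ∀ z ζ : ℝ → ℝ, HoldG K β z → HoldG K' β' ζ →
      (∀ x ∈ Icc a b, |z x| ≤ M) → ∀ r ∈ Ioc a b,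
      ‖fracDerivLeft α a z r * fracDerivRight α b ζ r‖ ≤ bd r := by
  have hG : 0 < Real.Gamma (1 - α) := Real.Gamma_pos_of_pos (by linarith)
  have hG' : 0 < Real.Gamma α := Real.Gamma_pos_of_pos (by linarith)
  refine ⟨fun r => ((1 / Real.Gamma (1 - α)) *
      ((r - a) ^ (-α) * M + α * (K * ((b - a) ^ (β - α) / (β - α))))) * ((1 / Real.Gamma α) *
      ((K' + (1 - α) * K' / (β' - (1 - α))) * (b - a) ^ (β' - (1 - α)))), ?_, ?_⟩
  · refine IntervalIntegrable.mul_const (IntervalIntegrable.const_mul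
      (IntervalIntegrable.add (IntervalIntegrable.mul_const (kern_ii' _ (by linarith) a b) _) ?_)
        _) _
    exact intervalIntegrable_const
  · intro z ζ hz hζ hM r hr
    have hK := hz.K_nonneg
    have hp : 0 < r - a := sub_pos.2 hr.1
    have hd : 0 < β - α := by linarith
    have hM0 : 0 ≤ M := (abs_nonneg _).trans (hM r ⟨hr.1.le, hr.2⟩)
    have hab : 0 ≤ b - a := by linarith
    rw [norm_mul]
    refine mul_le_mul ?_ (right_bound hζ hr.1.le hr.2 hβ' hα0 hα1) (norm_nonneg _) ?_
    · refine (left_bound hz hr.1 hβ hα0 hα1).trans ?_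
      have := hM r ⟨hr.1.le, hr.2⟩
      have := hr.2
      gcongr
    · positivity

lemma prod_ii {α β β' K K' a b : ℝ} {z ζ : ℝ → ℝ} (hz : HoldG K β z) (hζ : HoldG K' β' ζ)
    (hab : a ≤ b) (hβ : α < β) (hβ' : 1 - α < β')
    (hα0 : 0 < α) (hα1 : α < 1) :
    IntervalIntegrable (fun r => fracDerivLeft α a z r * fracDerivRight α b ζ r) volume a b := by
  have hzc := hz.cont (hα0.trans hβ)
  have hζc := hζ.cont (by linarith)
  obtain ⟨M, hM⟩ := isCompact_Icc.exists_bound_of_continuousOn (s := Icc a b) hzc.continuousOn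
  obtain ⟨bd, h1, h2⟩ := prod_dom (K := K) (K' := K') (M := M) hab hβ hβ' hα0 hα1
  refine h1.mono_fun' ((left_meas hzc).mul (right_meas hζc)).aestronglyMeasurable ?_
  refine (ae_restrict_mem measurableSet_uIoc).mono ?_
  intro r hr
  rw [uIoc_of_le hab] at hr
  exact h2 z ζ hz hζ hM r hr

lemma prod_tendsto {α β β' K K' a b M : ℝ} {z ζ : ℝ → ℝ} {zn ζn : ℕ → ℝ → ℝ}
    (hz : ∀ n, HoldG K β (zn n)) (hζ : ∀ n, HoldG K' β' (ζn n))
    (hab : a ≤ b) (hβ : α < β) (hβ' : 1 - α < β') (hα0 : 0 < α) (hα1 : α < 1)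
    (hM : ∀ n, ∀ x ∈ Icc a b, |zn n x| ≤ M)
    (ht : ∀ x, Filter.Tendsto (fun n => zn n x) Filter.atTop (nhds (z x)))
    (ht' : ∀ x, Filter.Tendsto (fun n => ζn n x) Filter.atTop (nhds (ζ x))) :
    Filter.Tendsto (fun n => ∫ r in a..b, fracDerivLeft α a (zn n) r * fracDerivRight α b (ζn n) r)
      Filter.atTop (nhds (∫ r in a..b, fracDerivLeft α a z r * fracDerivRight α b ζ r)) := by
  obtain ⟨bd, h1, h2⟩ := prod_dom (K := K) (K' := K') (M := M) hab hβ hβ' hα0 hα1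
  refine intervalIntegral.tendsto_integral_filter_of_dominated_convergence bd ?_ ?_ h1 ?_
  · exact Filter.Eventually.of_forall fun n => ((left_meas ((hz n).cont (by linarith))).mul
      (right_meas ((hζ n).cont (by linarith)))).aestronglyMeasurable
  · refine Filter.Eventually.of_forall fun n => Filter.Eventually.of_forall fun r hr => ?_
    rw [uIoc_of_le hab] at hr
    exact h2 _ _ (hz n) (hζ n) (hM n) r hr
  · refine Filter.Eventually.of_forall fun r hr => ?_
    rw [uIoc_of_le hab] at hr
    exact (left_tendsto hz hr.1.le hβ (by linarith) ht).mul
      (right_tendsto hζ hr.2 hβ' (by linarith) ht')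

lemma tri_swap {a b : ℝ} (hab : a ≤ b) {u v k : ℝ → ℝ}
    (hint : Integrable (fun p : ℝ × ℝ => (Ioc a b).indicator v p.1 *
      ((Ioc a b).indicator u p.2 * (Ioc 0 (b - a)).indicator k (p.1 - p.2)))
      (volume.prod volume)) :
    (∫ r in a..b, u r * ∫ q in r..b, k (q - r) * v q) =
      (∫ q in a..b, v q * ∫ r in a..q, k (q - r) * u r) ∧
    IntervalIntegrable (fun q => v q * ∫ r in a..q, k (q - r) * u r) volume a b := by
  have hA : ∀ q, (∫ r, (Ioc a b).indicator v q *
      ((Ioc a b).indicator u r * (Ioc 0 (b - a)).indicator k (q - r))) =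
      (Ioc a b).indicator (fun q => v q * ∫ r in a..q, k (q - r) * u r) q := by
    intro q
    rw [integral_const_mul]
    by_cases hq : q ∈ Ioc a b
    · rw [indicator_of_mem hq, indicator_of_mem hq]
      congr 1
      rw [intervalIntegral.integral_of_le hq.1.le, integral_Ioc_eq_integral_Ioo,
        ← integral_indicator measurableSet_Ioo]
      congr 1
      ext r
      by_cases hr : r ∈ Ioo a q
      · have h1 : r ∈ Ioc a b := ⟨hr.1, hr.2.le.trans hq.2⟩
        have h2 : q - r ∈ Ioc 0 (b - a) := ⟨by linarith [hr.2], by linarith [hr.1, hq.2]⟩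
        rw [indicator_of_mem h1, indicator_of_mem h2, indicator_of_mem hr, mul_comm]
      · rw [indicator_of_notMem hr]
        by_cases h1 : r ∈ Ioc a b
        · have h2 : q - r ∉ Ioc 0 (b - a) := fun h => hr ⟨h1.1, by linarith [h.1]⟩
          rw [indicator_of_notMem h2, mul_zero]
        · rw [indicator_of_notMem h1, zero_mul]
    · rw [indicator_of_notMem hq, indicator_of_notMem hq, zero_mul]
  have hB : ∀ r, (∫ q, (Ioc a b).indicator v q *
      ((Ioc a b).indicator u r * (Ioc 0 (b - a)).indicator k (q - r))) =
      (Ioc a b).indicator (fun r => u r * ∫ q in r..b, k (q - r) * v q) r := by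
    intro r
    simp_rw [mul_left_comm]
    rw [integral_const_mul]
    by_cases hr : r ∈ Ioc a b
    · rw [indicator_of_mem hr, indicator_of_mem hr]
      congr 1
      rw [intervalIntegral.integral_of_le hr.2, ← integral_indicator measurableSet_Ioc]
      congr 1
      ext q
      by_cases hq : q ∈ Ioc r b
      · have h1 : q ∈ Ioc a b := ⟨hr.1.trans hq.1, hq.2⟩
        have h2 : q - r ∈ Ioc 0 (b - a) := ⟨by linarith [hq.1], by linarith [hr.1, hq.2]⟩
        rw [indicator_of_mem h1, indicator_of_mem h2, indicator_of_mem hq, mul_comm]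
      · rw [indicator_of_notMem hq]
        by_cases h1 : q ∈ Ioc a b
        · have h2 : q - r ∉ Ioc 0 (b - a) := fun h => hq ⟨by linarith [h.1], h1.2⟩
          rw [indicator_of_notMem h2, mul_zero]
        · rw [indicator_of_notMem h1, zero_mul]
    · rw [indicator_of_notMem hr, indicator_of_notMem hr, zero_mul]
  constructor
  · have sw := integral_integral_swap (f := fun q r => (Ioc a b).indicator v q *
      ((Ioc a b).indicator u r * (Ioc 0 (b - a)).indicator k (q - r))) hint
    simp_rw [hA, hB] at sw
    rw [integral_indicator measurableSet_Ioc, integral_indicator measurableSet_Ioc] at sw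
    rw [intervalIntegral.integral_of_le hab, intervalIntegral.integral_of_le hab]
    exact sw.symm
  · have := hint.integral_prod_left
    simp_rw [hA] at this
    rw [intervalIntegrable_iff_integrableOn_Ioc_of_le hab]
    exact (integrable_indicator_iff measurableSet_Ioc).1 this

lemma hint1 {a b : ℝ} (hab : a ≤ b) {u v k : ℝ → ℝ} (hu : IntervalIntegrable u volume a b)
    (hk : IntervalIntegrable k volume 0 (b - a)) (hv : Continuous v) :
    Integrable (fun p : ℝ × ℝ => (Ioc a b).indicator v p.1 *
      ((Ioc a b).indicator u p.2 * (Ioc 0 (b - a)).indicator k (p.1 - p.2)))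
      (volume.prod volume) := by
  rw [intervalIntegrable_iff_integrableOn_Ioc_of_le hab] at hu
  rw [intervalIntegrable_iff_integrableOn_Ioc_of_le (by linarith)] at hk
  have h1 := Integrable.convolution_integrand (ContinuousLinearMap.mul ℝ ℝ) (μ := volume)
    (ν := volume)
    ((integrable_indicator_iff measurableSet_Ioc).2 hu)
    ((integrable_indicator_iff measurableSet_Ioc).2 hk)
  simp only [ContinuousLinearMap.mul_apply'] at h1
  obtain ⟨M, hM⟩ := isCompact_Icc.exists_bound_of_continuousOn (s := Icc a b) hv.continuousOn
  refine h1.bdd_mul (c := max M 0) ?_ ?_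
  · exact ((hv.measurable.indicator measurableSet_Ioc).comp measurable_fst).aestronglyMeasurable
  · refine Filter.Eventually.of_forall fun p => ?_
    by_cases hp : p.1 ∈ Ioc a b
    · rw [indicator_of_mem hp]
      exact (hM _ ⟨hp.1.le, hp.2⟩).trans (le_max_left _ _)
    · rw [indicator_of_notMem hp]; simp

lemma hint2 {a b : ℝ} (hab : a ≤ b) {u v k : ℝ → ℝ} (hv : IntervalIntegrable v volume a b)
    (hk : IntervalIntegrable k volume 0 (b - a)) (hu : Continuous u) :
    Integrable (fun p : ℝ × ℝ => (Ioc a b).indicator v p.1 *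
      ((Ioc a b).indicator u p.2 * (Ioc 0 (b - a)).indicator k (p.1 - p.2)))
      (volume.prod volume) := by
  rw [intervalIntegrable_iff_integrableOn_Ioc_of_le hab] at hv
  rw [intervalIntegrable_iff_integrableOn_Ioc_of_le (by linarith)] at hk
  have h1 := (Integrable.convolution_integrand (ContinuousLinearMap.mul ℝ ℝ) (μ := volume)
    (ν := volume)
    ((integrable_indicator_iff measurableSet_Ioc).2 hv)
    ((integrable_indicator_iff measurableSet_Ioc).2 hk).comp_neg).swap
  simp only [ContinuousLinearMap.mul_apply', Function.comp_def, Prod.fst_swap, Prod.snd_swap,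
    neg_sub] at h1
  obtain ⟨M, hM⟩ := isCompact_Icc.exists_bound_of_continuousOn (s := Icc a b) hu.continuousOn
  have h2 := h1.bdd_mul (c := max M 0) (f := fun p : ℝ × ℝ => (Ioc a b).indicator u p.2) ?_ ?_
  · refine h2.congr (Filter.Eventually.of_forall fun p => ?_)
    try simp only
    ring
  · exact ((hu.measurable.indicator measurableSet_Ioc).comp measurable_snd).aestronglyMeasurable
  · refine Filter.Eventually.of_forall fun p => ?_
    by_cases hp : p.2 ∈ Ioc a b
    · simp only [indicator_of_mem hp]
      exact (hM _ ⟨hp.1.le, hp.2⟩).trans (le_max_left _ _)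
    · simp only [indicator_of_notMem hp]; simp

/-- The Beta constant. -/
noncomputable def betaC (α : ℝ) : ℝ := ∫ x in (0 : ℝ)..1, (1 - x) ^ (α - 1) * x ^ (-α)

lemma beta_int (α : ℝ) {s q : ℝ} (h : s < q) :
    (∫ r in s..q, (q - r) ^ (α - 1) * (r - s) ^ (-α)) = betaC α := by
  have hp : 0 < q - s := sub_pos.2 h
  have e := intervalIntegral.smul_integral_comp_mul_add (a := 0) (b := 1)
    (fun r => (q - r) ^ (α - 1) * (r - s) ^ (-α)) (q - s) s
  have e1 : (q - s) * 0 + s = s := by ring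
  have e2 : (q - s) * 1 + s = q := by ring
  rw [e1, e2] at e
  rw [← e, betaC, smul_eq_mul, ← intervalIntegral.integral_const_mul]
  refine intervalIntegral.integral_congr fun x hx => ?_
  rw [uIcc_of_le zero_le_one] at hx
  try simp only
  have e3 : q - ((q - s) * x + s) = (q - s) * (1 - x) := by ring
  have e4 : (q - s) * x + s - s = (q - s) * x := by ring
  rw [e3, e4, Real.mul_rpow hp.le (by linarith [hx.2]), Real.mul_rpow hp.le hx.1]
  have e5 : (q - s) * ((q - s) ^ (α - 1) * (q - s) ^ (-α)) = 1 := by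
    rw [← Real.rpow_add hp]
    have : α - 1 + -α = -1 := by ring
    rw [this, Real.rpow_neg_one]
    field_simp
  linear_combination ((1 - x) ^ (α - 1) * x ^ (-α)) * e5

lemma beta_ii {α s q : ℝ} (hα0 : 0 < α) (hα1 : α < 1) (h : s < q) :
    IntervalIntegrable (fun r => (q - r) ^ (α - 1) * (r - s) ^ (-α)) volume s q := by
  have h1 : s < (s + q) / 2 := by linarith
  have h2 : (s + q) / 2 < q := by linarith
  refine IntervalIntegrable.trans (b := (s + q) / 2) ?_ ?_
  · refine (kern_ii' (-α) (by linarith) s _).continuousOn_mul ?_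
    intro r hr
    rw [uIcc_of_le h1.le] at hr
    exact (ContinuousAt.rpow_const (by fun_prop) (Or.inl (by linarith [hr.2]))).continuousWithinAt
  · refine (kern_ii (α - 1) (by linarith) _ q).mul_continuousOn ?_
    intro r hr
    rw [uIcc_of_le h2.le] at hr
    exact (ContinuousAt.rpow_const (by fun_prop) (Or.inl (by linarith [hr.1]))).continuousWithinAt

lemma inversion {α β K a q : ℝ} {f f' : ℝ → ℝ} (h : HoldG K β f) (ha : a < q) (hβ : α < β)
    (hα0 : 0 < α) (hα1 : α < 1) (hf : ∀ x, HasDerivAt f (f' x) x) (hf' : Continuous f') :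
    (∫ r in a..q, (q - r) ^ (α - 1) * fracDerivLeft α a f r) =
      (1 / Real.Gamma (1 - α)) * (betaC α * f q) := by
  obtain ⟨t1, t2⟩ := tri_swap ha.le (hint2 (u := f') (v := fun r => (q - r) ^ (α - 1))
    (k := fun x => x ^ (-α)) ha.le (kern_ii _ (by linarith) a q)
    (intervalIntegral.intervalIntegrable_rpow' (by linarith)) hf')
  have e1 : (∫ r in a..q, (q - r) ^ (α - 1) * fracDerivLeft α a f r) =
      ∫ r in a..q, (1 / Real.Gamma (1 - α)) * (f a * ((q - r) ^ (α - 1) * (r - a) ^ (-α)) +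
        (q - r) ^ (α - 1) * ∫ s in a..r, (r - s) ^ (-α) * f' s) := by
    rw [intervalIntegral.integral_of_le ha.le, intervalIntegral.integral_of_le ha.le]
    refine setIntegral_congr_fun measurableSet_Ioc fun r hr => ?_
    try simp only
    rw [left_C1 h hr.1 hβ hα0 hα1 hf hf']
    ring
  rw [e1, intervalIntegral.integral_const_mul,
    intervalIntegral.integral_add ((beta_ii hα0 hα1 ha).const_mul _) t2, ← t1,
    intervalIntegral.integral_const_mul, beta_int α ha]
  have e2 : (∫ s in a..q, f' s * ∫ r in s..q, (r - s) ^ (-α) * (q - r) ^ (α - 1)) =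
      ∫ s in a..q, f' s * betaC α := by
    rw [intervalIntegral.integral_of_le ha.le, intervalIntegral.integral_of_le ha.le,
      integral_Ioc_eq_integral_Ioo, integral_Ioc_eq_integral_Ioo]
    refine setIntegral_congr_fun measurableSet_Ioo fun s hs => ?_
    try simp only
    rw [← beta_int α hs.2]
    simp_rw [mul_comm]
  rw [e2, intervalIntegral.integral_mul_const,
    intervalIntegral.integral_eq_sub_of_hasDerivAt (fun x _ => hf x) (hf'.intervalIntegrable _ _)]
  ring

lemma left_ii {α β K a b : ℝ} {z : ℝ → ℝ} (hz : HoldG K β z) (hab : a ≤ b) (hβ : α < β)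
    (hα0 : 0 < α) (hα1 : α < 1) :
    IntervalIntegrable (fun r => fracDerivLeft α a z r) volume a b := by
  have hzc := hz.cont (hα0.trans hβ)
  have hG : 0 < Real.Gamma (1 - α) := Real.Gamma_pos_of_pos (by linarith)
  have hc : IntervalIntegrable (fun r => (1 / Real.Gamma (1 - α)) *
      ((r - a) ^ (-α) * |z r| + α * (K * ((r - a) ^ (β - α) / (β - α))))) volume a b := by
    refine IntervalIntegrable.const_mul (IntervalIntegrable.add
      ((kern_ii' _ (by linarith) a b).mul_continuousOn hzc.abs.continuousOn) ?_) _
    exact (((kern_ii' _ (by linarith) a b).div_const _).const_mul _).const_mul _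
  refine hc.mono_fun' (left_meas hzc).aestronglyMeasurable ?_
  refine (ae_restrict_mem measurableSet_uIoc).mono ?_
  intro r hr
  rw [uIoc_of_le hab] at hr
  exact left_bound hz hr.1 hβ hα0 hα1

lemma C1_formula {α β β' K K' a b : ℝ} {f f' g g' : ℝ → ℝ} (hf : HoldG K β f)
    (hg : HoldG K' β' g) (hab : a < b) (hβ : α < β) (hβ' : 1 - α < β')
    (hα0 : 0 < α) (hα1 : α < 1) (hfd : ∀ x, HasDerivAt f (f' x) x) (hf' : Continuous f')
    (hgd : ∀ x, HasDerivAt g (g' x) x) (hg' : Continuous g') :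
    (∫ r in a..b, fracDerivLeft α a f r * fracDerivRight α b g r) =
      -(1 / Real.Gamma α) * ((1 / Real.Gamma (1 - α)) * betaC α) * ∫ q in a..b, g' q * f q := by
  obtain ⟨t1, -⟩ := tri_swap hab.le (hint1 (u := fun r => fracDerivLeft α a f r) (v := g')
    (k := fun x => x ^ (α - 1)) hab.le (left_ii hf hab.le hβ hα0 hα1)
    (intervalIntegral.intervalIntegrable_rpow' (by linarith)) hg')
  have e1 : (∫ r in a..b, fracDerivLeft α a f r * fracDerivRight α b g r) =
      ∫ r in a..b, -(1 / Real.Gamma α) * (fracDerivLeft α a f r *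
        ∫ q in r..b, (q - r) ^ (α - 1) * g' q) := by
    rw [intervalIntegral.integral_of_le hab.le, intervalIntegral.integral_of_le hab.le,
      integral_Ioc_eq_integral_Ioo, integral_Ioc_eq_integral_Ioo]
    refine setIntegral_congr_fun measurableSet_Ioo fun r hr => ?_
    try simp only
    rw [right_C1 hg hr.2 hβ' hα0 hα1 hgd hg']
    ring
  have e2 : (∫ q in a..b, g' q * ∫ r in a..q, (q - r) ^ (α - 1) * fracDerivLeft α a f r) =
      ∫ q in a..b, ((1 / Real.Gamma (1 - α)) * betaC α) * (g' q * f q) := by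
    rw [intervalIntegral.integral_of_le hab.le, intervalIntegral.integral_of_le hab.le]
    refine setIntegral_congr_fun measurableSet_Ioc fun q hq => ?_
    try simp only
    rw [inversion hf hq.1 hβ hα0 hα1 hfd hf']
    ring
  rw [e1, intervalIntegral.integral_const_mul, t1, e2, intervalIntegral.integral_const_mul]
  ring

lemma approx {K β : ℝ} {z : ℝ → ℝ} (h : HoldG K β z) (hβ : 0 < β) :
    ∃ zn zn' : ℕ → ℝ → ℝ, (∀ n, HoldG K β (zn n)) ∧ (∀ n x, |zn n x| ≤ |z x| + K) ∧
      (∀ x, Filter.Tendsto (fun n => zn n x) Filter.atTop (nhds (z x))) ∧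
      (∀ n x, HasDerivAt (zn n) (zn' n x) x) ∧ (∀ n, Continuous (zn' n)) := by
  have hc := h.cont hβ
  have hK := h.K_nonneg
  have hclose : ∀ (n : ℕ) (x : ℝ),
      |(∫ u in (0 : ℝ)..1, z (x + u / ((n : ℝ) + 1))) - z x| ≤ K * (1 / ((n : ℝ) + 1)) ^ β := by
    intro n x
    have hn : (0 : ℝ) < (n : ℝ) + 1 := by positivity
    have e : (∫ u in (0 : ℝ)..1, z (x + u / ((n : ℝ) + 1))) - z x =
        ∫ u in (0 : ℝ)..1, (z (x + u / ((n : ℝ) + 1)) - z x) := by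
      rw [intervalIntegral.integral_sub ((by fun_prop : Continuous _).intervalIntegrable _ _)
        intervalIntegrable_const]
      simp
    rw [e]
    have := intervalIntegral.norm_integral_le_of_norm_le_const (a := 0) (b := 1)
      (f := fun u => z (x + u / ((n : ℝ) + 1)) - z x) (C := K * (1 / ((n : ℝ) + 1)) ^ β) ?_
    · simpa using this
    · intro u hu
      rw [uIoc_of_le zero_le_one] at hu
      refine (h x (x + u / ((n : ℝ) + 1))).trans ?_
      have e1 : x + u / ((n : ℝ) + 1) - x = u / ((n : ℝ) + 1) := by ring
      rw [e1, abs_of_nonneg (div_nonneg hu.1.le hn.le)]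
      have h1 := hu.1.le
      have h2 := hu.2
      gcongr
  refine ⟨fun n x => ∫ u in (0 : ℝ)..1, z (x + u / ((n : ℝ) + 1)),
    fun n x => ((n : ℝ) + 1) * (z (x + 1 / ((n : ℝ) + 1)) - z x), ?_, ?_, ?_, ?_, ?_⟩
  · intro n s t
    have e : (∫ u in (0 : ℝ)..1, z (t + u / ((n : ℝ) + 1))) -
        (∫ u in (0 : ℝ)..1, z (s + u / ((n : ℝ) + 1))) =
        ∫ u in (0 : ℝ)..1, (z (t + u / ((n : ℝ) + 1)) - z (s + u / ((n : ℝ) + 1))) := by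
      rw [intervalIntegral.integral_sub ((by fun_prop : Continuous _).intervalIntegrable _ _)
        ((by fun_prop : Continuous _).intervalIntegrable _ _)]
    try simp only
    rw [e]
    have := intervalIntegral.norm_integral_le_of_norm_le_const (a := 0) (b := 1)
      (f := fun u => z (t + u / ((n : ℝ) + 1)) - z (s + u / ((n : ℝ) + 1)))
      (C := K * |t - s| ^ β) ?_
    · simpa using this
    · intro u _
      have h1 := h (s + u / ((n : ℝ) + 1)) (t + u / ((n : ℝ) + 1))
      rwa [add_sub_add_right_eq_sub] at h1
  · intro n x
    have h1 := hclose n x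
    have h2 : (1 / ((n : ℝ) + 1)) ^ β ≤ 1 := by
      refine Real.rpow_le_one (by positivity) ?_ hβ.le
      rw [div_le_one (by positivity)]
      have : (0 : ℝ) ≤ n := n.cast_nonneg
      linarith
    have h3 : K * (1 / ((n : ℝ) + 1)) ^ β ≤ K := mul_le_of_le_one_right hK h2
    have h4 := abs_sub_abs_le_abs_sub (∫ u in (0 : ℝ)..1, z (x + u / ((n : ℝ) + 1))) (z x)
    try simp only
    linarith
  · intro x
    rw [tendsto_iff_dist_tendsto_zero]
    have h1 : Filter.Tendsto (fun n : ℕ => K * (1 / ((n : ℝ) + 1)) ^ β) Filter.atTop (nhds 0) := by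
      have := (tendsto_one_div_add_atTop_nhds_zero_nat (𝕜 := ℝ)).rpow_const
        (p := β) (Or.inr hβ.le)
      simpa [Real.zero_rpow hβ.ne'] using this.const_mul K
    exact squeeze_zero (fun _ => dist_nonneg) (fun n => hclose n x) h1
  · intro n x
    have hn : ((n : ℝ) + 1) ≠ 0 := by positivity
    have e : (fun x => ∫ u in (0 : ℝ)..1, z (x + u / ((n : ℝ) + 1))) =
        fun x => ((n : ℝ) + 1) * ((∫ y in (0 : ℝ)..(x + 1 / ((n : ℝ) + 1)), z y) -
          ∫ y in (0 : ℝ)..x, z y) := by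
      ext x
      rw [intervalIntegral.integral_interval_sub_left (hc.intervalIntegrable _ _)
        (hc.intervalIntegrable _ _), intervalIntegral.integral_comp_add_div z hn x]
      simp
    try simp only
    rw [e]
    have d1 := fun y => (hc.integral_hasStrictDerivAt 0 y).hasDerivAt
    exact (((d1 _).comp_add_const x (1 / ((n : ℝ) + 1))).sub (d1 x)).const_mul _
  · intro n
    fun_prop

lemma additive_glob {α β β' K K' T₁ T₂ T₃ : ℝ} {z ζ : ℝ → ℝ} (hz : HoldG K β z)
    (hζ : HoldG K' β' ζ) (hβ : α < β) (hβ' : 1 - α < β') (hα0 : 0 < α) (hα1 : α < 1)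
    (h12 : T₁ < T₂) (h23 : T₂ < T₃) :
    (∫ r in T₁..T₂, fracDerivLeft α T₁ z r * fracDerivRight α T₂ ζ r) +
        (∫ r in T₂..T₃, fracDerivLeft α T₂ z r * fracDerivRight α T₃ ζ r) =
      ∫ r in T₁..T₃, fracDerivLeft α T₁ z r * fracDerivRight α T₃ ζ r := by
  obtain ⟨zn, zn', z1, z2, z3, z4, z5⟩ := approx hz (hα0.trans hβ)
  obtain ⟨ζn, ζn', y1, -, y3, y4, y5⟩ := approx hζ (by linarith)
  have hzc := hz.cont (hα0.trans hβ)
  have lim : ∀ a b, a < b → Filter.Tendsto (fun n => ∫ r in a..b, fracDerivLeft α a (zn n) r *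
      fracDerivRight α b (ζn n) r)
      Filter.atTop (nhds (∫ r in a..b, fracDerivLeft α a z r * fracDerivRight α b ζ r)) := by
    intro a b hab
    obtain ⟨M, hM⟩ := isCompact_Icc.exists_bound_of_continuousOn (s := Icc a b) hzc.continuousOn
    exact prod_tendsto z1 y1 hab.le hβ hβ' hα0 hα1 (M := M + K)
      (fun n x hx => (z2 n x).trans (add_le_add_left (hM x hx) K)) z3 y3
  refine tendsto_nhds_unique ((lim _ _ h12).add (lim _ _ h23)) ?_
  refine (lim _ _ (h12.trans h23)).congr fun n => ?_
  have F := fun a b hab => C1_formula (a := a) (b := b) (z1 n) (y1 n) hab hβ hβ' hα0 hα1 (z4 n)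
    (z5 n) (y4 n) (y5 n)
  have ci : ∀ a b, IntervalIntegrable (fun q => ζn' n q * zn n q) volume a b := fun a b =>
    ((y5 n).mul ((z1 n).cont (hα0.trans hβ))).intervalIntegrable _ _
  rw [F _ _ h12, F _ _ h23, F _ _ (h12.trans h23),
    ← intervalIntegral.integral_add_adjacent_intervals (ci T₁ T₂) (ci T₂ T₃)]
  ring

/-- Extension of a Hölder function on an interval to the line. -/
lemma extend {K β T₁ T₃ : ℝ} {z : ℝ → ℝ} (hT : T₁ < T₃) (hβ : 0 < β)
    (hz : ∀ s t : ℝ, T₁ ≤ s → s ≤ t → t ≤ T₃ → |z t - z s| ≤ K * (t - s) ^ β) :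
    ∃ w : ℝ → ℝ, HoldG K β w ∧ ∀ x ∈ Icc T₁ T₃, w x = z x := by
  have hK : 0 ≤ K := by
    have h1 := (abs_nonneg _).trans (hz T₁ T₃ le_rfl hT.le le_rfl)
    exact nonneg_of_mul_nonneg_left h1 (Real.rpow_pos_of_pos (sub_pos.2 hT) _)
  have hz' : ∀ s ∈ Icc T₁ T₃, ∀ t ∈ Icc T₁ T₃, |z t - z s| ≤ K * |t - s| ^ β := by
    intro s hs t ht
    rcases le_total s t with h | h
    · rw [abs_of_nonneg (sub_nonneg.2 h)]
      exact hz s t hs.1 h ht.2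
    · rw [abs_sub_comm, abs_sub_comm t s, abs_of_nonneg (sub_nonneg.2 h)]
      exact hz t s ht.1 h hs.2
  refine ⟨fun x => z (projIcc T₁ T₃ hT.le x), ?_, ?_⟩
  · intro s t
    refine (hz' _ (projIcc T₁ T₃ hT.le s).2 _ (projIcc T₁ T₃ hT.le t).2).trans ?_
    have := abs_projIcc_sub_projIcc (c := t) (d := s) hT.le
    gcongr
  · intro x hx
    try simp only
    rw [projIcc_of_mem hT.le hx]

lemma left_congr {γ a r : ℝ} {z w : ℝ → ℝ} (ha : a ≤ r) (h : ∀ x ∈ Icc a r, w x = z x) :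
    fracDerivLeft γ a z r = fracDerivLeft γ a w r := by
  unfold fracDerivLeft
  rw [h r ⟨ha, le_rfl⟩]
  have : (∫ q in a..r, ((r - q) ^ (-(1 + γ))) * (z r - z q)) =
      ∫ q in a..r, ((r - q) ^ (-(1 + γ))) * (z r - w q) := by
    refine intervalIntegral.integral_congr fun q hq => ?_
    rw [uIcc_of_le ha] at hq
    try simp only
    rw [h q hq]
  rw [this]

lemma right_congr {α b r : ℝ} {z w : ℝ → ℝ} (hb : r ≤ b) (h : ∀ x ∈ Icc r b, w x = z x) :
    fracDerivRight α b z r = fracDerivRight α b w r := by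
  rw [right_eq_left, right_eq_left]
  refine left_congr (by linarith) fun x hx => ?_
  rw [h b ⟨hb, le_rfl⟩, h (-x) ⟨by linarith [hx.2], by linarith [hx.1]⟩]

/-- Additivity of the pathwise integral
`I(a,b) = ∫_a^b D^α_{a+}z[r]·D^{1−α}_{b−}ζ_{b−}[r] dr`: all these integrals are well
defined and `I(T₁,T₂) + I(T₂,T₃) = I(T₁,T₃)`. -/
theorem pathwise_integral_additive {α β β' T₁ T₂ T₃ : ℝ}
    (hβ : 1 / 2 < β) (hββ' : β < β') (hβ'1 : β' < 1) (hsum : 1 < β + β')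
    (hα1 : 1 - β' < α) (hα2 : α < β) (h12 : T₁ < T₂) (h23 : T₂ < T₃)
    (z ζ : ℝ → ℝ) (Kz Kζ : ℝ)
    (hz : ∀ s t : ℝ, T₁ ≤ s → s ≤ t → t ≤ T₃ → |z t - z s| ≤ Kz * (t - s) ^ β)
    (hζ : ∀ s t : ℝ, T₁ ≤ s → s ≤ t → t ≤ T₃ → |ζ t - ζ s| ≤ Kζ * (t - s) ^ β') :
    (∀ a b : ℝ, T₁ ≤ a → a ≤ b → b ≤ T₃ →
      IntervalIntegrable (fun r => fracDerivLeft α a z r * fracDerivRight α b ζ r)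
        volume a b) ∧
    (∫ r in T₁..T₂, fracDerivLeft α T₁ z r * fracDerivRight α T₂ ζ r) +
        (∫ r in T₂..T₃, fracDerivLeft α T₂ z r * fracDerivRight α T₃ ζ r) =
      ∫ r in T₁..T₃, fracDerivLeft α T₁ z r * fracDerivRight α T₃ ζ r := by

  have hα0 : 0 < α := by linarith
  have hα1 : α < 1 := by linarith
  have hT : T₁ < T₃ := h12.trans h23
  obtain ⟨w, w1, w2⟩ := extend hT (by linarith) hz
  obtain ⟨ω, ω1, ω2⟩ := extend hT (by linarith) hζ
  have hc : ∀ a b, T₁ ≤ a → b ≤ T₃ → ∀ r ∈ Icc a b,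
      fracDerivLeft α a w r * fracDerivRight α b ω r =
      fracDerivLeft α a z r * fracDerivRight α b ζ r := by
    intro a b ha hb r hr
    rw [left_congr (z := z) (w := w) hr.1
        fun x hx => w2 x ⟨ha.trans hx.1, hx.2.trans (hr.2.trans hb)⟩,
      right_congr (z := ζ) (w := ω) hr.2
        fun x hx => ω2 x ⟨(ha.trans hr.1).trans hx.1, hx.2.trans hb⟩]
  have hi : ∀ a b, T₁ ≤ a → a ≤ b → b ≤ T₃ →
      (∫ r in a..b, fracDerivLeft α a z r * fracDerivRight α b ζ r) =
      ∫ r in a..b, fracDerivLeft α a w r * fracDerivRight α b ω r := by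
    intro a b ha hab hb
    refine intervalIntegral.integral_congr fun r hr => ?_
    rw [uIcc_of_le hab] at hr
    exact (hc a b ha hb r hr).symm
  constructor
  · intro a b ha hab hb
    refine (prod_ii w1 ω1 hab hα2 (by linarith) hα0 hα1).congr ?_
    intro r hr
    rw [uIoc_of_le hab] at hr
    exact hc a b ha hb r ⟨hr.1.le, hr.2⟩
  · rw [hi _ _ le_rfl h12.le h23.le, hi _ _ h12.le h23.le le_rfl, hi _ _ le_rfl hT.le le_rfl]
    exact additive_glob w1 ω1 hα2 (by linarith) hα0 hα1 h12 h23
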